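/- (Lemma 3.19) The strongly focused calculus is closed under the display postulates: for all focused structures Π, Σ, Υ, (a) if Σ,Π ⊢ then Π,Σ ⊢; (b) if Π·⊗·Σ, Υ ⊢ then Π, Σ·⦸·Υ ⊢; (c) if Π, Σ·⊗·Υ ⊢ then Π·⊘·Σ, Υ ⊢. -/

import Mathlib

mutual
/-- Positive polarized formulas.  `rsub P N` denotes `P⊘N`, `lsub N P` denotes `N⦸P`. -/
inductive PFm : Type
  | pos : Nat → PFm               -- atom p
  | tens : PFm → PFm → PFm        -- P ⊗ Q
  | rsub : PFm → NFm → PFm        -- P ⊘ N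
  | lsub : NFm → PFm → PFm        -- N ⦸ P
  | disj : PFm → PFm → PFm        -- P ∨ Q
  | down : NFm → PFm              -- ↓N
/-- Negative polarized formulas.  `rdiv M Q` denotes `M/Q`, `ldiv Q M` denotes `Q\M`. -/
inductive NFm : Type
  | neg : Nat → NFm               -- atom p̄
  | par : NFm → NFm → NFm         -- M ⊕ N
  | ldiv : PFm → NFm → NFm        -- Q \ M
  | rdiv : NFm → PFm → NFm        -- M / Q
  | conj : NFm → NFm → NFm        -- M ∧ N
  | up : PFm → NFm                -- ↑P
end

mutual
/-- Polarized linear negation (positive to negative). -/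
def PFm.dual : PFm → NFm
  | .pos n => .neg n
  | .tens P Q => .par Q.dual P.dual        -- (P⊗Q)⊥ = Q⊥⊕P⊥
  | .rsub P N => .ldiv N.dual P.dual       -- (P⊘N)⊥ = N⊥\P⊥
  | .lsub N P => .rdiv P.dual N.dual       -- (N⦸P)⊥ = P⊥/N⊥
  | .disj P Q => .conj Q.dual P.dual       -- (P∨Q)⊥ = Q⊥∧P⊥
  | .down N => .up N.dual                  -- (↓N)⊥ = ↑(N⊥)
/-- Polarized linear negation (negative to positive). -/
def NFm.dual : NFm → PFm
  | .neg n => .pos n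
  | .par M N => .tens N.dual M.dual        -- (M⊕N)⊥ = N⊥⊗M⊥
  | .ldiv Q M => .rsub M.dual Q.dual       -- (Q\M)⊥ = M⊥⊘Q⊥
  | .rdiv M Q => .lsub Q.dual M.dual       -- (M/Q)⊥ = Q⊥⦸M⊥
  | .conj M N => .disj N.dual M.dual       -- (M∧N)⊥ = N⊥∨M⊥
  | .up P => .down P.dual                  -- (↑P)⊥ = ↓(P⊥)
end
/-- A polarized formula: either positive or negative. -/
abbrev Pol : Type := PFm ⊕ NFm

mutual
/-- The subformula map σ on negative polarized formulas. -/
def ssig : NFm → Set Pol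
  | .up P => insert (Sum.inr P.dual) (ttau P)       -- σ(↑P) = {P⊥} ∪ τ(P)
  | .neg n => {Sum.inr (.neg n)}
  | .conj M N => ssig M ∪ ssig N
  | .par M N => ssig M ∪ ssig N
  | .rdiv M Q => ssig M ∪ ttau Q
  | .ldiv Q M => ssig M ∪ ttau Q
/-- The subformula map τ on positive polarized formulas. -/
def ttau : PFm → Set Pol
  | .down N => insert (Sum.inr N) (ssig N)          -- τ(↓N) = {N} ∪ σ(N)
  | .pos n => {Sum.inl (.pos n)}
  | .disj P Q => ttau P ∪ ttau Q
  | .tens P Q => ttau P ∪ ttau Q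
  | .lsub N P => ttau P ∪ ssig N
  | .rsub P N => ttau P ∪ ssig N
end

/-- The closure X^τ = ⋃ { τ(↓N) | N ∈ X } of a set X of negative formulas. -/
def Xtau (X : Set NFm) : Set Pol := {a | ∃ N ∈ X, a ∈ ttau (.down N)}
/-- Focused structures: π ::= p | N | π·⊗·σ | π·⊘·σ | σ·⦸·π, where a negative formula `N`
stands for its implicit ↓-shift.  `slsub σ π` denotes `σ·⦸·π`, `srsub π σ` denotes `π·⊘·σ`. -/
inductive FStr : Type
  | at : Nat → FStr
  | nfm : NFm → FStr
  | stens : FStr → FStr → FStr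
  | srsub : FStr → FStr → FStr
  | slsub : FStr → FStr → FStr

/-- The decomposition relation `Tstar P σ`, i.e. `σ ∈ τ*(P)`:
τ*(P⊗Q)={π·⊗·σ | π∈τ*(P), σ∈τ*(Q)}, τ*(P⊘N)={π·⊘·σ | π∈τ*(P), σ∈τ*(N⊥)},
τ*(N⦸P)={σ·⦸·π | π∈τ*(P), σ∈τ*(N⊥)}, τ*(P∨Q)=τ*(P)∪τ*(Q), τ*(p)={p}, τ*(↓N)={N}. -/
inductive Tstar : PFm → FStr → Prop
  | tens {P Q π σ} : Tstar P π → Tstar Q σ → Tstar (.tens P Q) (.stens π σ)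
  | rsub {P N π σ} : Tstar P π → Tstar N.dual σ → Tstar (.rsub P N) (.srsub π σ)
  | lsub {N P π σ} : Tstar P π → Tstar N.dual σ → Tstar (.lsub N P) (.slsub σ π)
  | disjl {P Q π} : Tstar P π → Tstar (.disj P Q) π
  | disjr {P Q π} : Tstar Q π → Tstar (.disj P Q) π
  | at {n} : Tstar (.pos n) (.at n)
  | down {N} : Tstar (.down N) (.nfm N)
/-- One-hole contexts over focused structures. -/
inductive FCtx : Type
  | hole : FCtx
  | tensL : FCtx → FStr → FCtx      -- π[]·⊗·σ
  | tensR : FStr → FCtx → FCtx      -- π·⊗·σ[]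
  | rsubL : FCtx → FStr → FCtx      -- π[]·⊘·σ
  | rsubR : FStr → FCtx → FCtx      -- π·⊘·σ[]
  | lsubL : FCtx → FStr → FCtx      -- σ[]·⦸·π
  | lsubR : FStr → FCtx → FCtx      -- σ·⦸·π[]

/-- Substitution `π[υ]` of a structure for the hole of a context. -/
def FCtx.fill : FCtx → FStr → FStr
  | .hole, υ => υ
  | .tensL c σ, υ => .stens (c.fill υ) σ
  | .tensR π c, υ => .stens π (c.fill υ)
  | .rsubL c σ, υ => .srsub (c.fill υ) σ
  | .rsubR π c, υ => .srsub π (c.fill υ)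
  | .lsubL c π, υ => .slsub (c.fill υ) π
  | .lsubR σ c, υ => .slsub σ (c.fill υ)

/-- The display map `π[] ÷ υ`. -/
def FCtx.div : FCtx → FStr → FStr
  | .hole, υ => υ
  | .tensL c σ, υ => c.div (.slsub σ υ)       -- (π[]·⊗·σ)÷υ = π[]÷(σ·⦸·υ)
  | .tensR π c, υ => c.div (.srsub υ π)       -- (π·⊗·σ[])÷υ = σ[]÷(υ·⊘·π)
  | .rsubL c σ, υ => c.div (.stens σ υ)       -- (π[]·⊘·σ)÷υ = π[]÷(σ·⊗·υ)
  | .rsubR π c, υ => c.div (.slsub υ π)       -- (π·⊘·σ[])÷υ = σ[]÷(υ·⦸·π)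
  | .lsubR σ c, υ => c.div (.stens υ σ)       -- (σ·⦸·π[])÷υ = π[]÷(υ·⊗·σ)
  | .lsubL c π, υ => c.div (.srsub π υ)       -- (σ[]·⦸·π)÷υ = σ[]÷(π·⊘·υ)
mutual
/-- Strongly focused derivability of presentations `π,σ ⊢`, relative to the parameter
set `X` of negative formulas.  The rule (D) covers both presentation contexts
`ω[] = ⟨π[],σ⟩` and `ω[] = ⟨σ,π[]⟩`, with `ω*[] = π[]÷σ`. -/
inductive FSeq (X : Set NFm) : FStr → FStr → Prop
  | decL {N σ'} (c : FCtx) (υ : FStr) : Sum.inr N ∈ Xtau X → Tstar N.dual σ' →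
      FFoc X (c.div υ) σ' → FSeq X (c.fill (.nfm N)) υ
  | decR {N σ'} (c : FCtx) (υ : FStr) : Sum.inr N ∈ Xtau X → Tstar N.dual σ' →
      FFoc X (c.div υ) σ' → FSeq X υ (c.fill (.nfm N))
/-- Strongly focused derivability `π ⊢f σ` (context splitting judgement). -/
inductive FFoc (X : Set NFm) : FStr → FStr → Prop
  | id {n} : FFoc X (.at n) (.at n)
  | react {π N} : (∀ σ, Tstar N.dual σ → FSeq X π σ) → FFoc X π (.nfm N)
  | tens {π π' σ σ'} : FFoc X π π' → FFoc X σ σ' → FFoc X (.stens π σ) (.stens π' σ')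
  | rsub {π π' σ σ'} : FFoc X σ σ' → FFoc X π π' → FFoc X (.srsub π σ) (.srsub π' σ')
  | lsub {π π' σ σ'} : FFoc X σ σ' → FFoc X π π' → FFoc X (.slsub σ π) (.slsub σ' π')
end

/-- Lemma 3.19: the strongly focused calculus (relative to any parameter
set X of negative formulas) is closed under the display postulates. -/
theorem focused_display_closure (X : Set NFm) (π σ υ : FStr) :
    (FSeq X σ π → FSeq X π σ) ∧
    (FSeq X (.stens π σ) υ → FSeq X π (.slsub σ υ)) ∧
    (FSeq X π (.stens σ υ) → FSeq X (.srsub π σ) υ) := by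
  refine ⟨?_, ?_, ?_⟩
  · intro h
    cases h with
    | decL c _ hN hT hF => exact FSeq.decR c _ hN hT hF
    | decR c _ hN hT hF => exact FSeq.decL c _ hN hT hF
  · intro h
    generalize hA : FStr.stens π σ = A at h
    cases h with
    | decL c _ hN hT hF =>
      cases c <;> simp only [FCtx.fill, reduceCtorEq, FStr.stens.injEq] at hA
      · obtain ⟨rfl, rfl⟩ := hA
        exact FSeq.decL _ _ hN hT hF
      · obtain ⟨rfl, rfl⟩ := hA
        rename_i c'
        exact FSeq.decR (.lsubL c' υ) _ hN hT hF
    | decR c _ hN hT hF =>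
      subst hA
      exact FSeq.decR (.lsubR σ c) _ hN hT hF
  · intro h
    generalize hA : FStr.stens σ υ = A at h
    cases h with
    | decL c _ hN hT hF =>
      subst hA
      exact FSeq.decL (.rsubL c σ) _ hN hT hF
    | decR c _ hN hT hF =>
      cases c <;> simp only [FCtx.fill, reduceCtorEq, FStr.stens.injEq] at hA
      · obtain ⟨rfl, rfl⟩ := hA
        rename_i c'
        exact FSeq.decL (.rsubR π c') _ hN hT hF
      · obtain ⟨rfl, rfl⟩ := hA
        exact FSeq.decR _ _ hN hT hF
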